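/- Let F ∈ ℝ^{q×n} and E ∈ ℝ^{q×m} define the mixed constraint F x + E u ≤ 1 (componentwise, with 1 the all-ones vector in ℝ^q). Suppose there exist N ≥ 1, matrices L^w ∈ ℝ^{m×n} and symmetric positive definite matrices S^w ∈ ℝ^{n×n} for every word w of depth at most N−1 (write S₀ = S^∅), such that: (i) the 2n×2n block matrices [[S^w, (Ā_i S^w + B̄_i L^w)ᵀ], [Ā_i S^w + B̄_i L^w, S^{w·i}]] are positive definite for every word w of depth at most N−2 and every i ∈ {1,…,d}; (ii) the block matrices [[S^w, (Ā_i S^w + B̄_i L^w)ᵀ], [Ā_i S^w + B̄_i L^w, S₀]] are positive definite for every word w of depth exactly N−1 and every i ∈ {1,…,d}; (iii) there exist symmetric matrices H^w ∈ ℝ^{q×q} for every word w of depth at most N−1 such that the (q+n)×(q+n) block matrices [[H^w, F S^w + E L^w], [(F S^w + E L^w)ᵀ, S^w]] are positive semidefinite and every diagonal entry of every H^w is at most 1. Set K^w = L^w (S^w)⁻¹ and P₀ = S₀⁻¹. Consider the linear interpolating tree periodic closed loop: for any x₀ ∈ ℝⁿ and any admissible uncertainty sequence (α_t), for each m ∈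 ℕ set s = mN and define tree states y^∅ = x_s and y^{w·i} = (Ā_i + B̄_i K^w) y^w for words w of depth at most N−1, weights β^∅ = 1 and β^{w·i} = α_{s+|w|, i} β^w, and for k = 0,…,N−1 let x_{s+k+1} = A_{s+k} x_{s+k} + B_{s+k} u_{s+k} with u_{s+k} = Σ_{|w|=k} β^w K^w y^w. Then for every x₀ with x₀ᵀ P₀ x₀ ≤ 1 and every admissible uncertainty sequence: F x_t + E u_t ≤ 1 for all t ∈ ℕ, x_Nᵀ P₀ x_N ≤ 1 (so the ellipsoid {x : xᵀ P₀ x ≤ 1} is robust periodic invariant with period N), and there exist c ≥ 1 and λ ∈ (0,1) with ‖x_t‖ ≤ c λ^t ‖x₀‖ for all t ∈ ℕ. -/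

import Mathlib

open Matrix

/-- Euclidean norm on `Fin n → ℝ`. -/
noncomputable def eNorm {n : ℕ} (x : Fin n → ℝ) : ℝ := Real.sqrt (∑ i, x i ^ 2)

lemma eNorm_eq_sqrt_dotProduct {n : ℕ} (x : Fin n → ℝ) : eNorm x = Real.sqrt (x ⬝ᵥ x) := by
  simp only [eNorm, dotProduct, sq]

/-- Every quadratic form is dominated by a multiple of a positive definite one. -/
lemma Matrix.PosDef.exists_forall_dotProduct_mulVec_le {ι : Type*} [Fintype ι]
    {A : Matrix ι ι ℝ} (hA : A.PosDef) (B : Matrix ι ι ℝ) :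
    ∃ C : ℝ, 1 ≤ C ∧ ∀ x : ι → ℝ, x ⬝ᵥ B *ᵥ x ≤ C * (x ⬝ᵥ A *ᵥ x) := by
  have hpos : ∀ x : ι → ℝ, x ≠ 0 → 0 < x ⬝ᵥ A *ᵥ x := fun x hx => by
    simpa using hA.dotProduct_mulVec_pos hx
  have hcont : ∀ M : Matrix ι ι ℝ, Continuous fun x : ι → ℝ => x ⬝ᵥ M *ᵥ x := fun M => by
    fun_prop
  have hK : IsCompact (Metric.sphere (0 : ι → ℝ) 1) := isCompact_sphere 0 1
  have hf : ContinuousOn (fun x : ι → ℝ => (x ⬝ᵥ B *ᵥ x) / (x ⬝ᵥ A *ᵥ x))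
      (Metric.sphere (0 : ι → ℝ) 1) := by
    refine (hcont B).continuousOn.div (hcont A).continuousOn fun x hx => (hpos x ?_).ne'
    exact ne_zero_of_mem_unit_sphere (⟨x, hx⟩ : Metric.sphere (0 : ι → ℝ) 1)
  obtain ⟨C, hC⟩ := hK.bddAbove_image hf
  refine ⟨max 1 C, le_max_left _ _, fun x => ?_⟩
  rcases eq_or_ne x 0 with rfl | hx
  · simp
  have hnx : 0 < ‖x‖ := norm_pos_iff.mpr hx
  have hmem : ‖x‖⁻¹ • x ∈ Metric.sphere (0 : ι → ℝ) 1 := by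
    simp [norm_smul, hnx.ne']
  have hle := hC (Set.mem_image_of_mem _ hmem)
  simp only [mulVec_smul, dotProduct_smul, smul_dotProduct, smul_eq_mul] at hle
  have hinv : ‖x‖⁻¹ ≠ 0 := inv_ne_zero hnx.ne'
  rw [mul_div_mul_left _ _ hinv, mul_div_mul_left _ _ hinv, div_le_iff₀ (hpos x hx)] at hle
  exact hle.trans (mul_le_mul_of_nonneg_right (le_max_right _ _) (hpos x hx).le)

/-- Jensen's inequality for a positive semidefinite quadratic form. -/
lemma Matrix.PosSemidef.dotProduct_mulVec_sum_le {ι κ : Type*} [Fintype ι] [Fintype κ]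
    {P : Matrix ι ι ℝ} (hP : P.PosSemidef) (b : κ → ℝ) (hb : ∀ k, 0 ≤ b k)
    (hb1 : ∑ k, b k = 1) (y : κ → ι → ℝ) :
    (∑ k, b k • y k) ⬝ᵥ P *ᵥ (∑ k, b k • y k) ≤ ∑ k, b k * (y k ⬝ᵥ P *ᵥ y k) := by
  set z := ∑ k, b k • y k with hz
  have hsum : z ⬝ᵥ P *ᵥ z = ∑ k, b k * (y k ⬝ᵥ P *ᵥ z) := by
    conv_lhs => rw [hz]
    rw [sum_dotProduct]
    simp only [smul_dotProduct, smul_eq_mul]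
    rfl
  have hsum' : z ⬝ᵥ P *ᵥ z = ∑ k, b k * (z ⬝ᵥ P *ᵥ y k) := by
    nth_rewrite 2 [hz]
    rw [mulVec_sum, dotProduct_sum]
    simp only [mulVec_smul, dotProduct_smul, smul_eq_mul]
  have hnn : 0 ≤ ∑ k, b k * ((y k - z) ⬝ᵥ P *ᵥ (y k - z)) :=
    Finset.sum_nonneg fun k _ => mul_nonneg (hb k) (by
      simpa using hP.dotProduct_mulVec_nonneg (y k - z))
  simp only [mulVec_sub, dotProduct_sub, sub_dotProduct, mul_sub, Finset.sum_sub_distrib,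
    ← Finset.sum_mul, hb1, one_mul] at hnn
  linarith

/-- The LMI `[[S, Mᵀ], [M, S']] ≻ 0` makes `M * S⁻¹` a strict contraction from the norm of `S⁻¹`
to the norm of `S'⁻¹`. -/
lemma eventually_forall_dotProduct_inv_mulVec_le {ι κ : Type*} [Fintype ι] [DecidableEq ι]
    [Fintype κ] [DecidableEq κ] {S : Matrix ι ι ℝ} {S' : Matrix κ κ ℝ} {M : Matrix κ ι ℝ}
    (hS : S.PosDef) (hS' : S'.PosDef) (h : (fromBlocks S Mᵀ M S').PosDef) :
    ∀ᶠ ρ : ℝ in nhdsWithin 1 (Set.Iio 1), ∀ y : ι → ℝ,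
      ((M * S⁻¹) *ᵥ y) ⬝ᵥ S'⁻¹ *ᵥ ((M * S⁻¹) *ᵥ y) ≤ ρ * (y ⬝ᵥ S⁻¹ *ᵥ y) := by
  obtain ⟨C, hC1, hC⟩ := h.exists_forall_dotProduct_mulVec_le (fromBlocks S 0 0 0)
  have hC0 : 0 < C := by linarith
  have hlt : 1 - C⁻¹ < 1 := by have := inv_pos.mpr hC0; linarith
  filter_upwards [mem_nhdsWithin_of_mem_nhds (Ioi_mem_nhds hlt)] with ρ hρ y
  have hρ' : 1 - C⁻¹ < ρ := hρ
  have hSu : IsUnit S.det := (isUnit_iff_isUnit_det S).mp hS.isUnit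
  have hSu' : IsUnit S'.det := (isUnit_iff_isUnit_det S').mp hS'.isUnit
  set v := S⁻¹ *ᵥ y with hv
  set z := (M * S⁻¹) *ᵥ y with hz
  set p := S'⁻¹ *ᵥ z with hp
  have hSv : S *ᵥ v = y := by rw [hv, mulVec_mulVec, mul_nonsing_inv _ hSu, one_mulVec]
  have hSp : S' *ᵥ p = z := by rw [hp, mulVec_mulVec, mul_nonsing_inv _ hSu', one_mulVec]
  have hMv : M *ᵥ v = z := by rw [hv, mulVec_mulVec]
  have hcross : v ⬝ᵥ Mᵀ *ᵥ p = z ⬝ᵥ p := by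
    rw [mulVec_transpose, dotProduct_comm, ← dotProduct_mulVec, hMv, dotProduct_comm]
  have key := hC (Sum.elim v (-p))
  simp only [fromBlocks_mulVec, Sum.elim_comp_inl, Sum.elim_comp_inr, sumElim_dotProduct_sumElim,
    mulVec_neg, hSv, hSp, hMv, zero_mulVec, dotProduct_add, dotProduct_neg, neg_dotProduct,
    dotProduct_zero, hcross, neg_zero, add_zero] at key
  rw [dotProduct_comm v y, dotProduct_comm p z] at key
  have h0 : 0 ≤ y ⬝ᵥ v := by simpa using hS.inv.posSemidef.dotProduct_mulVec_nonneg y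
  have h1 : C⁻¹ * (y ⬝ᵥ v) ≤ y ⬝ᵥ v - z ⬝ᵥ p := by
    rw [inv_mul_le_iff₀ hC0]; linarith
  nlinarith

/-- The LMI `[[H, M], [Mᵀ, S]] ⪰ 0` with `H j j ≤ 1` bounds the `j`-th coordinate of `M * S⁻¹` by
one on the unit ellipsoid of `S⁻¹`. -/
lemma mul_inv_mulVec_apply_le_one {ι κ : Type*} [Fintype ι] [DecidableEq ι]
    [Fintype κ] [DecidableEq κ] {S : Matrix ι ι ℝ} {H : Matrix κ κ ℝ} {M : Matrix κ ι ℝ}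
    (hS : S.PosDef) (h : (fromBlocks H M Mᵀ S).PosSemidef) {j : κ} (hj : H j j ≤ 1)
    {y : ι → ℝ} (hy : y ⬝ᵥ S⁻¹ *ᵥ y ≤ 1) : ((M * S⁻¹) *ᵥ y) j ≤ 1 := by
  have hSu : IsUnit S.det := (isUnit_iff_isUnit_det S).mp hS.isUnit
  set v := S⁻¹ *ᵥ y with hv
  have hSv : S *ᵥ v = y := by rw [hv, mulVec_mulVec, mul_nonsing_inv _ hSu, one_mulVec]
  have key := h.dotProduct_mulVec_nonneg (Sum.elim (Pi.single j 1) (-v))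
  have hcross : v ⬝ᵥ Mᵀ.col j = (M *ᵥ v) j := dotProduct_comm _ _
  simp only [star_trivial, fromBlocks_mulVec, Sum.elim_comp_inl, Sum.elim_comp_inr,
    sumElim_dotProduct_sumElim, mulVec_neg, hSv, dotProduct_add, dotProduct_neg, neg_dotProduct,
    hcross, single_one_dotProduct, mulVec_single_one, col_apply] at key
  rw [dotProduct_comm v y] at key
  rw [← mulVec_mulVec, ← hv]
  linarith

/-- Summing over words of length `t + 1` by splitting off the last letter. -/
lemma sum_words_succ {d t : ℕ} {G : Type*} [AddCommMonoid G] (f : (Fin (t + 1) → Fin d) → G) :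
    ∑ w, f w = ∑ w : Fin t → Fin d, ∑ i : Fin d,
      f (Fin.snoc (α := fun _ : Fin (t + 1) => Fin d) w i) := by
  rw [← (Fin.snocEquiv fun _ : Fin (t + 1) => Fin d).sum_comp, Fintype.sum_prod_type,
    Finset.sum_comm]
  rfl

lemma eNorm_le_of_sq_le {n : ℕ} {x y : Fin n → ℝ} {a : ℝ} (ha : 0 ≤ a)
    (h : x ⬝ᵥ x ≤ a ^ 2 * (y ⬝ᵥ y)) : eNorm x ≤ a * eNorm y := by
  rw [eNorm_eq_sqrt_dotProduct, eNorm_eq_sqrt_dotProduct, ← Real.sqrt_sq ha,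
    ← Real.sqrt_mul (sq_nonneg a)]
  simpa [Real.sqrt_sq ha] using Real.sqrt_le_sqrt h

/-- Product weights on the words of a scenario tree are nonnegative and sum to one at each depth. -/
lemma tree_weights_nonneg_and_sum {d : ℕ} {a : ℕ → Fin d → ℝ} (ha : ∀ t i, 0 ≤ a t i)
    (ha1 : ∀ t, ∑ i, a t i = 1) {b : ∀ t : ℕ, (Fin t → Fin d) → ℝ} (hb0 : ∀ w, b 0 w = 1)
    (hb : ∀ (t : ℕ) (w : Fin t → Fin d) (i : Fin d),
      b (t + 1) (Fin.snoc w i) = a t i * b t w) (t : ℕ) :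
    (∀ w, 0 ≤ b t w) ∧ ∑ w, b t w = 1 := by
  induction t with
  | zero => exact ⟨fun w => by rw [hb0]; exact zero_le_one, by simp [hb0]⟩
  | succ t ih =>
    refine ⟨fun w => ?_, ?_⟩
    · rw [← Fin.snoc_init_self w]
      exact (hb t (Fin.init w) (w (Fin.last t))).symm ▸ mul_nonneg (ha _ _) (ih.1 _)
    · rw [sum_words_succ]
      simp only [hb, ← Finset.sum_mul, ha1, one_mul, ih.2]

/-- The plant state is the interpolation of the tree states. -/
lemma state_eq_sum_tree {n m d N : ℕ} {A : Fin d → Matrix (Fin n) (Fin n) ℝ}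
    {B : Fin d → Matrix (Fin n) (Fin m) ℝ}
    {K : ∀ t : ℕ, (Fin t → Fin d) → Matrix (Fin m) (Fin n) ℝ} {a : ℕ → Fin d → ℝ}
    {b : ∀ t : ℕ, (Fin t → Fin d) → ℝ} (hb0 : ∀ w, b 0 w = 1)
    (hb : ∀ (t : ℕ) (w : Fin t → Fin d) (i : Fin d),
      b (t + 1) (Fin.snoc w i) = a t i * b t w)
    {x : ℕ → Fin n → ℝ} {u : ℕ → Fin m → ℝ} {y : ∀ t : ℕ, (Fin t → Fin d) → Fin n → ℝ}
    (hy0 : ∀ w, y 0 w = x 0)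
    (hy : ∀ t, t < N → ∀ (w : Fin t → Fin d) (i : Fin d),
      y (t + 1) (Fin.snoc w i) = (A i + B i * K t w) *ᵥ y t w)
    (hu : ∀ t, t < N → u t = ∑ w : Fin t → Fin d, b t w • K t w *ᵥ y t w)
    (hx : ∀ t, x (t + 1) = (∑ i, a t i • A i) *ᵥ x t + (∑ i, a t i • B i) *ᵥ u t)
    (t : ℕ) (ht : t ≤ N) : x t = ∑ w, b t w • y t w := by
  induction t with
  | zero => simp [hb0, hy0]
  | succ t ih =>
    rw [sum_words_succ, hx, ih (by omega), hu t ht]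
    simp only [hb, hy t ht, sum_mulVec, mulVec_sum, smul_mulVec, mulVec_smul, add_mulVec,
      ← mulVec_mulVec, smul_add, Finset.sum_add_distrib, Finset.smul_sum, smul_smul]
    simp only [mul_comm (b t _)]

theorem stmt_15 (n m d q : ℕ) (hn : 0 < n) (hm : 0 < m) (hd : 0 < d) (hq : 0 < q)
    (Abar : Fin d → Matrix (Fin n) (Fin n) ℝ)
    (Bbar : Fin d → Matrix (Fin n) (Fin m) ℝ)
    (F : Matrix (Fin q) (Fin n) ℝ) (E : Matrix (Fin q) (Fin m) ℝ)
    (N : ℕ) (hN : 1 ≤ N)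
    (L : ∀ t : ℕ, (Fin t → Fin d) → Matrix (Fin m) (Fin n) ℝ)
    (S : ∀ t : ℕ, (Fin t → Fin d) → Matrix (Fin n) (Fin n) ℝ)
    (hSpos : ∀ t, t < N → ∀ w : Fin t → Fin d, (S t w).PosDef)
    -- (i) the stability LMIs
    (h1 : ∀ t, t + 2 ≤ N → ∀ (w : Fin t → Fin d) (i : Fin d),
      (fromBlocks (S t w) (Abar i * S t w + Bbar i * L t w)ᵀ
        (Abar i * S t w + Bbar i * L t w) (S (t + 1) (Fin.snoc w i))).PosDef)
    -- (ii) the wrap-around LMIs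
    (h2 : ∀ (w : Fin (N - 1) → Fin d) (i : Fin d),
      (fromBlocks (S (N - 1) w) (Abar i * S (N - 1) w + Bbar i * L (N - 1) w)ᵀ
        (Abar i * S (N - 1) w + Bbar i * L (N - 1) w) (S 0 Fin.elim0)).PosDef)
    -- (iii) the constraint LMIs
    (H : ∀ t : ℕ, (Fin t → Fin d) → Matrix (Fin q) (Fin q) ℝ)
    (hHsym : ∀ t, t < N → ∀ w : Fin t → Fin d, (H t w).IsHermitian)
    (h3 : ∀ t, t < N → ∀ w : Fin t → Fin d,
      (fromBlocks (H t w) (F * S t w + E * L t w)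
        (F * S t w + E * L t w)ᵀ (S t w)).PosSemidef)
    (h4 : ∀ t, t < N → ∀ (w : Fin t → Fin d) (j : Fin q), H t w j j ≤ 1) :
    -- with the gains `K t w = L t w * (S t w)⁻¹` and `P₀ = S₀⁻¹`:
    ∃ c : ℝ, 1 ≤ c ∧ ∃ lam : ℝ, lam ∈ Set.Ioo (0 : ℝ) 1 ∧
      ∀ (α : ℕ → Fin d → ℝ), (∀ t i, 0 ≤ α t i) → (∀ t, ∑ i, α t i = 1) →
      ∀ (x : ℕ → Fin n → ℝ) (u : ℕ → Fin m → ℝ)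
        (y : ℕ → ∀ t : ℕ, (Fin t → Fin d) → Fin n → ℝ)
        (β : ℕ → ∀ t : ℕ, (Fin t → Fin d) → ℝ),
        -- tree states simulated at the beginning of each period `p`
        (∀ (p : ℕ) (w : Fin 0 → Fin d), y p 0 w = x (p * N)) →
        (∀ (p t : ℕ), t < N → ∀ (w : Fin t → Fin d) (i : Fin d),
          y p (t + 1) (Fin.snoc w i) =
            (Abar i + Bbar i * (L t w * (S t w)⁻¹)).mulVec (y p t w)) →
        -- interpolation weights
        (∀ (p : ℕ) (w : Fin 0 → Fin d), β p 0 w = 1) →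
        (∀ (p t : ℕ) (w : Fin t → Fin d) (i : Fin d),
          β p (t + 1) (Fin.snoc w i) = α (p * N + t) i * β p t w) →
        -- the interpolating tree periodic inputs
        (∀ (p k : ℕ), k < N →
          u (p * N + k) =
            ∑ w : Fin k → Fin d, β p k w • (L k w * (S k w)⁻¹).mulVec (y p k w)) →
        -- closed-loop plant
        (∀ t : ℕ, x (t + 1) =
          (∑ i, α t i • Abar i).mulVec (x t) + (∑ i, α t i • Bbar i).mulVec (u t)) →
        -- initial state in the ellipsoid of `P₀ = S₀⁻¹`
        x 0 ⬝ᵥ (S 0 Fin.elim0)⁻¹.mulVec (x 0) ≤ 1 →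
        -- constraint satisfaction, periodic invariance, exponential stability
        (∀ (t : ℕ) (j : Fin q), (F.mulVec (x t) + E.mulVec (u t)) j ≤ 1) ∧
        x N ⬝ᵥ (S 0 Fin.elim0)⁻¹.mulVec (x N) ≤ 1 ∧
        ∀ t, eNorm (x t) ≤ c * lam ^ t * eNorm (x 0) := by
  classical
  set S₀ := S 0 Fin.elim0 with hS₀
  have hnil : ∀ w : Fin 0 → Fin d, w = Fin.elim0 := fun w => Subsingleton.elim _ _
  set T : ∀ t : ℕ, (Fin t → Fin d) → Matrix (Fin n) (Fin n) ℝ :=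
    fun t w => if t < N then S t w else S₀ with hT
  have hTlt : ∀ t, t < N → ∀ w : Fin t → Fin d, T t w = S t w := fun t ht w => if_pos ht
  have hT0 : ∀ w : Fin 0 → Fin d, T 0 w = S₀ := fun w => by
    rw [hTlt 0 (by omega), hnil w]
  have hTN : ∀ w : Fin N → Fin d, T N w = S₀ := fun w => if_neg (lt_irrefl N)
  have hS₀pos : S₀.PosDef := hSpos 0 (by omega) _
  have hTpos : ∀ t (w : Fin t → Fin d), (T t w).PosDef := fun t w => by
    by_cases ht : t < N
    · rw [hTlt t ht]; exact hSpos t ht w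
    · rw [show T t w = S₀ from if_neg ht]; exact hS₀pos
  have hblock : ∀ t, t < N → ∀ (w : Fin t → Fin d) (i : Fin d),
      (fromBlocks (T t w) (Abar i * T t w + Bbar i * L t w)ᵀ
        (Abar i * T t w + Bbar i * L t w) (T (t + 1) (Fin.snoc w i))).PosDef := by
    intro t ht w i
    rw [hTlt t ht]
    rcases Nat.lt_or_ge (t + 1) N with h | h
    · rw [hTlt _ h]
      exact h1 t (by omega) w i
    · obtain rfl : N = t + 1 := by omega
      rw [hTN]
      exact h2 w i
  have hgain : ∀ {k : ℕ} (P : Matrix (Fin k) (Fin n) ℝ) (Q : Matrix (Fin k) (Fin m) ℝ) (t : ℕ)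
      (w : Fin t → Fin d), t < N →
      P + Q * (L t w * (S t w)⁻¹) = (P * S t w + Q * L t w) * (S t w)⁻¹ := by
    intro k P Q t w ht
    have hdet : IsUnit (S t w).det := (isUnit_iff_isUnit_det _).mp (hSpos t ht w).isUnit
    rw [Matrix.add_mul, Matrix.mul_assoc P, mul_nonsing_inv _ hdet, Matrix.mul_one,
      Matrix.mul_assoc]
  obtain ⟨ρ, hρ, hρ1, hρ0⟩ : ∃ ρ : ℝ, (∀ t ∈ Finset.range N, ∀ (w : Fin t → Fin d) (i : Fin d)
      (z : Fin n → ℝ), (((Abar i * T t w + Bbar i * L t w) * (T t w)⁻¹) *ᵥ z) ⬝ᵥ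
        (T (t + 1) (Fin.snoc w i))⁻¹ *ᵥ
          (((Abar i * T t w + Bbar i * L t w) * (T t w)⁻¹) *ᵥ z) ≤
        ρ * (z ⬝ᵥ (T t w)⁻¹ *ᵥ z)) ∧ ρ < 1 ∧ 0 < ρ := by
    have hev := (Finset.eventually_all (Finset.range N) (l := nhdsWithin (1 : ℝ) (Set.Iio 1))
      (p := fun t ρ => ∀ (w : Fin t → Fin d) (i : Fin d)
      (z : Fin n → ℝ), (((Abar i * T t w + Bbar i * L t w) * (T t w)⁻¹) *ᵥ z) ⬝ᵥ
        (T (t + 1) (Fin.snoc w i))⁻¹ *ᵥ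
          (((Abar i * T t w + Bbar i * L t w) * (T t w)⁻¹) *ᵥ z) ≤
        ρ * (z ⬝ᵥ (T t w)⁻¹ *ᵥ z))).mpr fun t ht =>
      Filter.eventually_all.mpr fun w => Filter.eventually_all.mpr fun i =>
        eventually_forall_dotProduct_inv_mulVec_le (hTpos _ _) (hTpos _ _)
          (hblock t (Finset.mem_range.mp ht) w i)
    exact (hev.and (Filter.Eventually.and self_mem_nhdsWithin
      (mem_nhdsWithin_of_mem_nhds (Ioi_mem_nhds one_pos)))).exists
  obtain ⟨C, hC1, hC⟩ : ∃ C : ℝ, 1 ≤ C ∧ ∀ t ∈ Finset.range N, ∀ (w : Fin t → Fin d)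
      (z : Fin n → ℝ), z ⬝ᵥ z ≤ C * (z ⬝ᵥ (T t w)⁻¹ *ᵥ z) := by
    have hev := (Finset.eventually_all (Finset.range N) (l := Filter.atTop)
      (p := fun t (C : ℝ) => ∀ (w : Fin t → Fin d) (z : Fin n → ℝ),
        z ⬝ᵥ z ≤ C * (z ⬝ᵥ (T t w)⁻¹ *ᵥ z))).mpr fun t _ =>
      Filter.eventually_all.mpr fun w => by
        obtain ⟨C, -, hC⟩ := (hTpos t w).inv.exists_forall_dotProduct_mulVec_le 1
        filter_upwards [Filter.eventually_ge_atTop C] with C' hC' z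
        have := hC z
        rw [one_mulVec] at this
        exact this.trans (mul_le_mul_of_nonneg_right hC' (by
          simpa using (hTpos t w).inv.posSemidef.dotProduct_mulVec_nonneg z))
    exact ((Filter.eventually_ge_atTop 1).and hev).exists
  obtain ⟨D, hD1, hD⟩ := (PosDef.one : (1 : Matrix (Fin n) (Fin n) ℝ).PosDef
    ).exists_forall_dotProduct_mulVec_le S₀⁻¹
  have hTnn : ∀ t (w : Fin t → Fin d) (z : Fin n → ℝ), 0 ≤ z ⬝ᵥ (T t w)⁻¹ *ᵥ z := fun t w z => by
    simpa using (hTpos t w).inv.posSemidef.dotProduct_mulVec_nonneg z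
  have hS₀nn : ∀ z : Fin n → ℝ, 0 ≤ z ⬝ᵥ S₀⁻¹ *ᵥ z := fun z => by
    simpa using hS₀pos.inv.posSemidef.dotProduct_mulVec_nonneg z
  have hNpos : 0 < 2 * N := by omega
  set lam : ℝ := ρ ^ (1 / ((2 * N : ℕ) : ℝ)) with hlam
  have hlam0 : 0 < lam := Real.rpow_pos_of_pos hρ0 _
  have hlam1 : lam < 1 := Real.rpow_lt_one hρ0.le hρ1 (by positivity)
  have hlamN : lam ^ (2 * N) = ρ := by
    rw [hlam, one_div, Real.rpow_inv_natCast_pow hρ0.le hNpos.ne']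
  have hCD : 1 ≤ C * D / ρ := by
    rw [le_div_iff₀ hρ0]
    nlinarith
  refine ⟨Real.sqrt (C * D / ρ), Real.one_le_sqrt.mpr hCD, lam, ⟨hlam0, hlam1⟩, ?_⟩
  intro α hα hα1 x u y β hy0 hy hβ0 hβ hu hx hx0
  have hβ01 : ∀ p t, (∀ w, 0 ≤ β p t w) ∧ ∑ w, β p t w = 1 := fun p =>
    tree_weights_nonneg_and_sum (a := fun t => α (p * N + t)) (fun t => hα _) (fun t => hα1 _)
      (hβ0 p) (hβ p)
  have hxy : ∀ p t, t ≤ N → x (p * N + t) = ∑ w, β p t w • y p t w := fun p =>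
    state_eq_sum_tree (x := fun t => x (p * N + t)) (u := fun t => u (p * N + t)) (hβ0 p) (hβ p)
      (hy0 p) (hy p) (hu p) (fun t => hx _)
  have hstep : ∀ p t, t < N → ∀ (w : Fin t → Fin d) (i : Fin d),
      y p (t + 1) (Fin.snoc w i) ⬝ᵥ (T (t + 1) (Fin.snoc w i))⁻¹ *ᵥ y p (t + 1) (Fin.snoc w i) ≤
        ρ * (y p t w ⬝ᵥ (T t w)⁻¹ *ᵥ y p t w) := by
    intro p t ht w i
    have := hρ t (Finset.mem_range.mpr ht) w i (y p t w)
    rwa [hTlt t ht w, ← hgain _ _ t w ht, ← hy p t ht w i, ← hTlt t ht w] at this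
  have hdec : ∀ p t, t ≤ N → ∀ w : Fin t → Fin d,
      y p t w ⬝ᵥ (T t w)⁻¹ *ᵥ y p t w ≤ ρ ^ t * (x (p * N) ⬝ᵥ S₀⁻¹ *ᵥ x (p * N)) := by
    intro p t
    induction t with
    | zero => intro _ w; rw [hy0, hT0, pow_zero, one_mul]
    | succ t ih =>
      intro ht w
      rw [← Fin.snoc_init_self w]
      refine (hstep p t ht (Fin.init w) (w (Fin.last t))).trans ?_
      rw [pow_succ', mul_assoc]
      exact mul_le_mul_of_nonneg_left (ih (by omega) _) hρ0.le
  have hdec' : ∀ p t, t ≤ N → ∀ w : Fin t → Fin d,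
      y p t w ⬝ᵥ (T t w)⁻¹ *ᵥ y p t w ≤ x (p * N) ⬝ᵥ S₀⁻¹ *ᵥ x (p * N) := fun p t ht w =>
    (hdec p t ht w).trans
      (mul_le_of_le_one_left (hS₀nn _) (pow_le_one₀ hρ0.le hρ1.le))
  have havg : ∀ p t (f : (Fin t → Fin d) → ℝ) (c : ℝ), (∀ w, f w ≤ c) →
      ∑ w, β p t w * f w ≤ c := by
    intro p t f c hf
    calc ∑ w, β p t w * f w ≤ ∑ w, β p t w * c :=
          Finset.sum_le_sum fun w _ => mul_le_mul_of_nonneg_left (hf w) ((hβ01 p t).1 w)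
      _ = c := by rw [← Finset.sum_mul, (hβ01 p t).2, one_mul]
  have hperiod : ∀ p, x ((p + 1) * N) ⬝ᵥ S₀⁻¹ *ᵥ x ((p + 1) * N) ≤
      ρ * (x (p * N) ⬝ᵥ S₀⁻¹ *ᵥ x (p * N)) := by
    intro p
    rw [add_mul, one_mul, hxy p N le_rfl]
    refine (hS₀pos.inv.posSemidef.dotProduct_mulVec_sum_le _ (hβ01 p N).1 (hβ01 p N).2 _).trans
      (havg p N _ _ fun w => ?_)
    have := hdec p N le_rfl w
    rw [hTN] at this
    exact this.trans (mul_le_mul_of_nonneg_right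
      (pow_le_of_le_one hρ0.le hρ1.le (by omega)) (hS₀nn _))
  have hpow : ∀ p, x (p * N) ⬝ᵥ S₀⁻¹ *ᵥ x (p * N) ≤ ρ ^ p * (x 0 ⬝ᵥ S₀⁻¹ *ᵥ x 0) := by
    intro p
    induction p with
    | zero => simp
    | succ p ih =>
      refine (hperiod p).trans ?_
      rw [pow_succ', mul_assoc]
      exact mul_le_mul_of_nonneg_left ih hρ0.le
  have hinv : ∀ p, x (p * N) ⬝ᵥ S₀⁻¹ *ᵥ x (p * N) ≤ 1 := fun p =>
    (hpow p).trans (mul_le_one₀ (pow_le_one₀ hρ0.le hρ1.le) (hS₀nn _) hx0)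
  refine ⟨fun t j => ?_, by simpa using hinv 1, fun t => ?_⟩
  · obtain ⟨p, k, hk, rfl⟩ : ∃ p k, k < N ∧ t = p * N + k :=
      ⟨t / N, t % N, Nat.mod_lt _ (by omega), (Nat.div_add_mod' t N).symm⟩
    have hFE : F *ᵥ x (p * N + k) + E *ᵥ u (p * N + k) =
        ∑ w, β p k w • (F + E * (L k w * (S k w)⁻¹)) *ᵥ y p k w := by
      rw [hxy p k hk.le, hu p k hk]
      simp only [mulVec_sum, mulVec_smul, add_mulVec, smul_add, Finset.sum_add_distrib,
        mulVec_mulVec]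
    rw [hFE, Finset.sum_apply]
    simp only [Pi.smul_apply, smul_eq_mul]
    refine havg p k _ 1 fun w => ?_
    rw [hgain _ _ k w hk]
    refine mul_inv_mulVec_apply_le_one (hSpos k hk w) (h3 k hk w) (h4 k hk w j) ?_
    rw [← hTlt k hk w]
    exact (hdec' p k hk.le w).trans (hinv p)
  · obtain ⟨p, k, hk, rfl⟩ : ∃ p k, k < N ∧ t = p * N + k :=
      ⟨t / N, t % N, Nat.mod_lt _ (by omega), (Nat.div_add_mod' t N).symm⟩
    refine eNorm_le_of_sq_le (by positivity) ?_
    have hnorm : x (p * N + k) ⬝ᵥ x (p * N + k) ≤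
        C * (x (p * N) ⬝ᵥ S₀⁻¹ *ᵥ x (p * N)) := by
      have hjensen := (PosDef.one : (1 : Matrix (Fin n) (Fin n) ℝ).PosDef
        ).posSemidef.dotProduct_mulVec_sum_le _ (hβ01 p k).1 (hβ01 p k).2 (y p k)
      simp only [one_mulVec] at hjensen
      rw [hxy p k hk.le]
      exact hjensen.trans (havg p k _ _ fun w => (hC k (Finset.mem_range.mpr hk) w _).trans
        (mul_le_mul_of_nonneg_left (hdec' p k hk.le w) (by linarith)))
    have hD0 := hD (x 0)
    rw [one_mulVec] at hD0
    have hxx : 0 ≤ x 0 ⬝ᵥ x 0 := by simpa using dotProduct_star_self_nonneg (x 0)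
    have hrate : ρ ^ p * ρ ≤ (lam ^ (p * N + k)) ^ 2 := by
      rw [← pow_succ, ← hlamN, ← pow_mul, ← pow_mul]
      exact pow_le_pow_of_le_one hlam0.le hlam1.le (by nlinarith)
    calc x (p * N + k) ⬝ᵥ x (p * N + k)
        ≤ C * (ρ ^ p * (D * (x 0 ⬝ᵥ x 0))) := by
          refine hnorm.trans (mul_le_mul_of_nonneg_left ((hpow p).trans ?_) (by linarith))
          exact mul_le_mul_of_nonneg_left hD0 (by positivity)
      _ = C * D / ρ * (ρ ^ p * ρ) * (x 0 ⬝ᵥ x 0) := by field_simp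
      _ ≤ C * D / ρ * (lam ^ (p * N + k)) ^ 2 * (x 0 ⬝ᵥ x 0) :=
          mul_le_mul_of_nonneg_right
            (mul_le_mul_of_nonneg_left hrate (by linarith)) hxx
      _ = _ := by rw [mul_pow, Real.sq_sqrt (by linarith)]
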